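/- arXiv:2502.12519 — 10 statements merged into one kernel-verified Lean document; each statement's English description precedes it below -/
import Mathlib

section
/- Let x, y be vertices and t ≥ 0 a real number with |N[x] ∩ N[y]| > t. If 𝒞' is a clustering of V in which x and y lie in different clusters, then obj(𝒞') > t/2. -/
open Finset

/-- Closed neighborhood of a vertex (the vertex together with its neighbors), as a finset. -/
def closedNbr {V : Type*} [Fintype V] [DecidableEq V]
    (G : SimpleGraph V) [DecidableRel G.Adj] (v : V) : Finset V :=
  insert v (G.neighborFinset v)

/-- Objective of a clustering `C` (given as the map sending each vertex to its cluster):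
the maximum disagreement `|N[v] Δ C v|` over all vertices `v`. -/
def clObj {V : Type*} [Fintype V] [DecidableEq V]
    (G : SimpleGraph V) [DecidableRel G.Adj] (C : V → Finset V) : ℕ :=
  Finset.univ.sup fun v => (symmDiff (closedNbr G v) (C v)).card

/-- If $|N[x] ∩ N[y]| > t$ and the clustering $C'$ places $x$ and $y$ in different
clusters, then $obj(C') > t/2$. -/
theorem diff_cluster_large_intersection
    {V : Type*} [Fintype V] [DecidableEq V]
    (G : SimpleGraph V) [DecidableRel G.Adj]
    (x y : V) (t : ℝ) (ht : 0 ≤ t)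
    (hxy : t < ((closedNbr G x ∩ closedNbr G y).card : ℝ))
    (C : V → Finset V)
    (hCmem : ∀ z, z ∈ C z)
    (hCpart : ∀ z w, z ∈ C w → C z = C w)
    (hdiff : C x ≠ C y) :
    t / 2 < (clObj G C : ℝ) := by
  have hsub : closedNbr G x ∩ closedNbr G y ⊆
      symmDiff (closedNbr G x) (C x) ∪ symmDiff (closedNbr G y) (C y) := by
    intro v hv
    rw [mem_inter] at hv
    have hv_not : ¬ (v ∈ C x ∧ v ∈ C y) := fun h =>
      hdiff ((hCpart v x h.1).symm.trans (hCpart v y h.2))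
    simp only [mem_union, mem_symmDiff]
    tauto
  have hle (z : V) : (symmDiff (closedNbr G z) (C z)).card ≤ clObj G C :=
    le_sup (f := fun v => (symmDiff (closedNbr G v) (C v)).card) (mem_univ z)
  have hcard : (closedNbr G x ∩ closedNbr G y).card ≤ clObj G C + clObj G C :=
    (card_le_card hsub).trans ((card_union_le _ _).trans (add_le_add (hle x) (hle y)))
  have hcast : ((closedNbr G x ∩ closedNbr G y).card : ℝ) ≤ clObj G C + clObj G C := by
    exact_mod_cast hcard
  linarith
end

section
/- Let x, y be vertices and t ≥ 0 a real number with |N[x] Δ N[y]| > t. If 𝒞' is a clustering of V in which x and y lie in the same cluster, then obj(𝒞') > t/2. -/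
open Finset

/-- If $|N[x] Δ N[y]| > t$ and the clustering $C'$ places $x$ and $y$ in the same
cluster, then $obj(C') > t/2$. -/
theorem same_cluster_large_symmDiff
    {V : Type*} [Fintype V] [DecidableEq V]
    (G : SimpleGraph V) [DecidableRel G.Adj]
    (x y : V) (t : ℝ) (ht : 0 ≤ t)
    (hxy : t < ((symmDiff (closedNbr G x) (closedNbr G y)).card : ℝ))
    (C : V → Finset V)
    (hCmem : ∀ z, z ∈ C z)
    (hCpart : ∀ z w, z ∈ C w → C z = C w)
    (hsame : C x = C y) :
    t / 2 < (clObj G C : ℝ) := by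
  have le_clObj (v : V) : (symmDiff (closedNbr G v) (C v)).card ≤ clObj G C :=
    Finset.le_sup (f := fun v => (symmDiff (closedNbr G v) (C v)).card) (Finset.mem_univ v)
  have htri : (symmDiff (closedNbr G x) (closedNbr G y)).card ≤
      (symmDiff (closedNbr G x) (C x)).card + (symmDiff (closedNbr G y) (C y)).card := by
    rw [← hsame, symmDiff_comm (closedNbr G y)]
    exact (Finset.card_le_card (symmDiff_triangle _ (C x) _)).trans (Finset.card_union_le _ _)
  have hle : ((symmDiff (closedNbr G x) (closedNbr G y)).card : ℝ) ≤ clObj G C + clObj G C :=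
    mod_cast htri.trans (add_le_add (le_clObj x) (le_clObj y))
  linarith
end

section
/- Let φ ≥ 0 and η ∈ [0,1) be real numbers, and let 𝒞* be a clustering with obj(𝒞*) ≤ φ. Let E' ⊆ V × V be any symmetric relation on vertices such that (i) whenever |N[u] Δ N[v]| ≤ 2φ one has (u,v) ∈ E', and (ii) whenever (u,v) ∈ E' one has |N[u] Δ N[v]| ≤ (1+η)·2φ. For u ∈ V_high, let L_u denote the connected component of u in the graph on vertex set V_high whose edges are the pairs of E' with both endpoints in V_high. Then for every u ∈ V_high, L_u = 𝒞*_u ∩ V_high. -/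
open Finset

theorem degree_le_card_closedNbr {V : Type*} [Fintype V] [DecidableEq V]
    (G : SimpleGraph V) [DecidableRel G.Adj] (v : V) :
    G.degree v ≤ (closedNbr G v).card :=
  Finset.card_le_card (Finset.subset_insert v (G.neighborFinset v))

theorem card_symmDiff_le_clObj {V : Type*} [Fintype V] [DecidableEq V]
    (G : SimpleGraph V) [DecidableRel G.Adj] (C : V → Finset V) (v : V) :
    (symmDiff (closedNbr G v) (C v)).card ≤ clObj G C :=
  Finset.le_sup (f := fun v => (symmDiff (closedNbr G v) (C v)).card) (Finset.mem_univ v)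

theorem card_symmDiff_triangle {α : Type*} [DecidableEq α] (s t r : Finset α) :
    (symmDiff s r).card ≤ (symmDiff s t).card + (symmDiff t r).card :=
  (Finset.card_le_card (symmDiff_triangle s t r)).trans (Finset.card_union_le _ _)

theorem card_le_card_symmDiff_add {α : Type*} [DecidableEq α] (s t : Finset α) :
    s.card ≤ (symmDiff s t).card + t.card := by
  simpa only [← Finset.bot_eq_empty, symmDiff_bot] using card_symmDiff_triangle s t ⊥

/-- If two vertices lie in disjoint clusters, their degrees are controlled by the symmetric
difference of their closed neighborhoods and the objective. -/
theorem degree_add_degree_le_of_disjoint {V : Type*} [Fintype V] [DecidableEq V]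
    (G : SimpleGraph V) [DecidableRel G.Adj] (C : V → Finset V) {a b : V}
    (hab : Disjoint (C a) (C b)) :
    G.degree a + G.degree b ≤
      (symmDiff (closedNbr G a) (closedNbr G b)).card + 4 * clObj G C := by
  have hcard : (symmDiff (C a) (C b)).card = (C a).card + (C b).card := by
    rw [hab.symmDiff_eq_sup, Finset.sup_eq_union, Finset.card_union_of_disjoint hab]
  have h₁ := card_symmDiff_triangle (C a) (closedNbr G a) (C b)
  have h₂ := card_symmDiff_triangle (closedNbr G a) (closedNbr G b) (C b)
  rw [symmDiff_comm (C a) (closedNbr G a)] at h₁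
  have ha := card_le_card_symmDiff_add (closedNbr G a) (C a)
  have hb := card_le_card_symmDiff_add (closedNbr G b) (C b)
  have hda := degree_le_card_closedNbr G a
  have hdb := degree_le_card_closedNbr G b
  have hoa := card_symmDiff_le_clObj G C a
  have hob := card_symmDiff_le_clObj G C b
  omega

/-- High-degree nodes clustering: the connected component of a high-degree vertex $u$
in the similarity graph on $V_{high}$ coincides with $C^*_u ∩ V_{high}$. -/
theorem high_degree_clustering
    {V : Type*} [Fintype V] [DecidableEq V]
    (G : SimpleGraph V) [DecidableRel G.Adj]
    (φ η : ℝ) (hφ : 0 ≤ φ) (hη0 : 0 ≤ η) (hη1 : η < 1)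
    (Cs : V → Finset V)
    (hCmem : ∀ z, z ∈ Cs z)
    (hCpart : ∀ z w, z ∈ Cs w → Cs z = Cs w)
    (hobj : (clObj G Cs : ℝ) ≤ φ)
    (E' : V → V → Prop)
    (hsymm : ∀ a b, E' a b → E' b a)
    (hE1 : ∀ a b, ((symmDiff (closedNbr G a) (closedNbr G b)).card : ℝ) ≤ 2 * φ → E' a b)
    (hE2 : ∀ a b, E' a b → ((symmDiff (closedNbr G a) (closedNbr G b)).card : ℝ) ≤ (1 + η) * (2 * φ))
    (u : V) (hu : (3 + η) * φ < (G.degree u : ℝ)) :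
    ∀ w : V,
      Relation.ReflTransGen
        (fun a b => E' a b ∧ (3 + η) * φ < (G.degree a : ℝ) ∧ (3 + η) * φ < (G.degree b : ℝ))
        u w
      ↔ (w ∈ Cs u ∧ (3 + η) * φ < (G.degree w : ℝ)) := by
  have heq : ∀ a b, E' a b → (3 + η) * φ < (G.degree a : ℝ) →
      (3 + η) * φ < (G.degree b : ℝ) → Cs a = Cs b := by
    intro a b hE ha hb
    by_contra hne
    have hdisj : Disjoint (Cs a) (Cs b) :=
      Finset.disjoint_left.2 fun z hza hzb => hne ((hCpart z a hza).symm.trans (hCpart z b hzb))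
    have h : (G.degree a + G.degree b : ℝ) ≤
        (symmDiff (closedNbr G a) (closedNbr G b)).card + 4 * clObj G Cs :=
      mod_cast degree_add_degree_le_of_disjoint G Cs hdisj
    linarith [hE2 a b hE]
  intro w
  constructor
  · intro h
    induction h with
    | refl => exact ⟨hCmem u, hu⟩
    | tail _ hbc ih =>
      obtain ⟨hE, hb, hc⟩ := hbc
      refine ⟨?_, hc⟩
      rw [← hCpart _ _ ih.1, heq _ _ hE hb hc]
      exact hCmem _
  · rintro ⟨hw, hdw⟩
    refine Relation.ReflTransGen.single ⟨hE1 u w ?_, hu, hdw⟩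
    have h : (symmDiff (closedNbr G u) (closedNbr G w)).card ≤ 2 * clObj G Cs := by
      have htri := card_symmDiff_triangle (closedNbr G u) (Cs u) (closedNbr G w)
      have hou := card_symmDiff_le_clObj G Cs u
      have how := card_symmDiff_le_clObj G Cs w
      rw [hCpart w u hw, symmDiff_comm] at how
      omega
    have h' : ((symmDiff (closedNbr G u) (closedNbr G w)).card : ℝ) ≤ 2 * clObj G Cs :=
      mod_cast h
    linarith
end

section
/- Let φ ≥ 0 and η ∈ [0,1) be real numbers, and let 𝒞* be a clustering with obj(𝒞*) ≤ φ. Let u and v be vertices with deg(u) > (3+η)φ and deg(v) > (3+η)φ lying in different clusters of 𝒞* (𝒞*_u ≠ 𝒞*_v), and let w be a vertex with deg(w) ≤ (3+η)φ. If w ∈ 𝒞*_u and |N[v] ∩ N[u] ∩ N[w]| ≤ φ, then |N[v] Δ N[w]| > (1+η)·2φ. -/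
open Finset

theorem card_symmDiff_eq_add {α : Type*} [DecidableEq α] (s t : Finset α) :
    (symmDiff s t).card = (s \ t).card + (t \ s).card :=
  card_union_of_disjoint disjoint_sdiff_sdiff

/-- If `K` and `L` are disjoint, then the overlap of `A` and `B` is controlled by the differences
of `A` from `L` and of `B` and `C` from `K`, together with the triple intersection. -/
theorem card_add_card_le_card_symmDiff_add {α : Type*} [DecidableEq α] {A B C K L : Finset α}
    (hKL : Disjoint K L) :
    A.card + C.card ≤ (symmDiff A B).card + (A ∩ C ∩ B).card + (symmDiff A L).card
      + (symmDiff B K).card + (symmDiff C K).card := by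
  have hAB : (A ∩ B).card ≤ (A \ L).card + (B \ K).card := by
    refine (card_le_card fun x hx => ?_).trans (card_union_le _ _)
    have hx_notMem : x ∈ K → x ∉ L := fun h => Finset.disjoint_left.mp hKL h
    simp only [mem_inter, mem_union, mem_sdiff] at hx ⊢
    tauto
  have hABC : (A ∩ B).card ≤ (A ∩ C ∩ B).card + (K \ C).card + (B \ K).card := by
    refine (card_le_card fun x hx => ?_).trans
      ((card_union_le (A ∩ C ∩ B ∪ K \ C) (B \ K)).trans
        (Nat.add_le_add_right (card_union_le _ _) _))
    simp only [mem_inter, mem_union, mem_sdiff] at hx ⊢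
    tauto
  have h₁ := card_sdiff_add_card_inter A B
  have h₂ := card_sdiff_add_card_inter B A
  have h₃ := card_sdiff_add_card_inter B K
  have h₄ := card_sdiff_add_card_inter K B
  have h₅ := card_sdiff_add_card_inter C K
  have h₆ := card_sdiff_add_card_inter K C
  rw [inter_comm B A] at h₂
  rw [inter_comm K B] at h₄
  rw [inter_comm K C] at h₆
  simp only [card_symmDiff_eq_add]
  omega

/-- No stealing, easy case: under the assumption $|N[v] ∩ N[u] ∩ N[w]| ≤ φ$. -/
theorem no_stealing_easy
    {V : Type*} [Fintype V] [DecidableEq V]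
    (G : SimpleGraph V) [DecidableRel G.Adj]
    (φ η : ℝ) (hφ : 0 ≤ φ) (hη0 : 0 ≤ η) (hη1 : η < 1)
    (Cs : V → Finset V)
    (hCmem : ∀ z, z ∈ Cs z)
    (hCpart : ∀ z w, z ∈ Cs w → Cs z = Cs w)
    (hobj : (clObj G Cs : ℝ) ≤ φ)
    (u v w : V)
    (hu : (3 + η) * φ < (G.degree u : ℝ))
    (hv : (3 + η) * φ < (G.degree v : ℝ))
    (huv : Cs u ≠ Cs v)
    (hw : (G.degree w : ℝ) ≤ (3 + η) * φ)
    (hwu : w ∈ Cs u)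
    (hint : ((closedNbr G v ∩ closedNbr G u ∩ closedNbr G w).card : ℝ) ≤ φ) :
    (1 + η) * (2 * φ) < ((symmDiff (closedNbr G v) (closedNbr G w)).card : ℝ) := by
  have hdisj : Disjoint (Cs u) (Cs v) := Finset.disjoint_left.mpr fun x hxu hxv =>
    huv ((hCpart x u hxu).symm.trans (hCpart x v hxv))
  have hcount := card_add_card_le_card_symmDiff_add (A := closedNbr G v) (B := closedNbr G w)
    (C := closedNbr G u) hdisj
  have hdis (z : V) : ((symmDiff (closedNbr G z) (Cs z)).card : ℝ) ≤ φ :=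
    (Nat.cast_le.mpr (card_symmDiff_le_clObj G Cs z)).trans hobj
  have hdeg (z : V) : (G.degree z : ℝ) ≤ (closedNbr G z).card :=
    Nat.cast_le.mpr (degree_le_card_closedNbr G z)
  rw [← hCpart w u hwu] at hcount
  have hu' := hdis u
  rw [← hCpart w u hwu] at hu'
  have hcount' := (Nat.cast_le (α := ℝ)).mpr hcount
  push_cast at hcount'
  linarith [hdis v, hdis w, hdeg u, hdeg v]
end

section
/- Let φ ≥ 0 and η ∈ [0,1) be real numbers, and let 𝒞* be a clustering with obj(𝒞*) ≤ φ. Let u and v be vertices with deg(u) > (3+η)φ and deg(v) > (3+η)φ lying in different clusters of 𝒞* (𝒞*_u ≠ 𝒞*_v), and let w ∈ 𝒞*_u be a vertex with deg(w) ≤ (3+η)φ. Suppose |N[w] ∩ N[v] ∩ N[u]| = φ + t for some real t > 0. Then |N[w] Δ N[u]| ≤ 2(φ − t). -/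
open Finset

theorem card_symmDiff_closedNbr_le_clObj {V : Type*} [Fintype V] [DecidableEq V]
    (G : SimpleGraph V) [DecidableRel G.Adj] (C : V → Finset V) (z : V) :
    (symmDiff (closedNbr G z) (C z)).card ≤ clObj G C :=
  Finset.le_sup (f := fun v => (symmDiff (closedNbr G v) (C v)).card) (mem_univ z)

/-- Elements common to `A` and `B` but outside `C` are saved twice in the triangle inequality
for the symmetric difference. -/
theorem card_symmDiff_add_two_mul_card_inter_sdiff_le {α : Type*} [DecidableEq α]
    (A B C : Finset α) :
    (symmDiff A B).card + 2 * ((A ∩ B) \ C).card ≤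
      (symmDiff A C).card + (symmDiff B C).card := by
  have hsub : symmDiff A B ∪ (A ∩ B) \ C ⊆ symmDiff A C ∪ symmDiff B C := by
    intro x
    simp only [mem_union, mem_symmDiff, mem_sdiff, mem_inter]
    tauto
  have hdisj : Disjoint (symmDiff A B) ((A ∩ B) \ C) := by
    rw [Finset.disjoint_left]
    intro x
    simp only [mem_symmDiff, mem_sdiff, mem_inter]
    tauto
  have hinter : (A ∩ B) \ C ⊆ symmDiff A C ∩ symmDiff B C := by
    intro x
    simp only [mem_symmDiff, mem_sdiff, mem_inter]
    tauto
  have h₁ := card_le_card hsub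
  have h₂ := card_le_card hinter
  have h₃ := card_union_add_card_inter (symmDiff A C) (symmDiff B C)
  rw [card_union_of_disjoint hdisj] at h₁
  omega

/-- Large intersection: if $|N[w] ∩ N[v] ∩ N[u]| = φ + t$ with $t > 0$, then
$|N[w] Δ N[u]| ≤ 2(φ - t)$. -/
theorem large_intersection
    {V : Type*} [Fintype V] [DecidableEq V]
    (G : SimpleGraph V) [DecidableRel G.Adj]
    (φ η : ℝ) (hφ : 0 ≤ φ) (hη0 : 0 ≤ η) (hη1 : η < 1)
    (Cs : V → Finset V)
    (hCmem : ∀ z, z ∈ Cs z)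
    (hCpart : ∀ z w, z ∈ Cs w → Cs z = Cs w)
    (hobj : (clObj G Cs : ℝ) ≤ φ)
    (u v w : V)
    (hu : (3 + η) * φ < (G.degree u : ℝ))
    (hv : (3 + η) * φ < (G.degree v : ℝ))
    (huv : Cs u ≠ Cs v)
    (hwu : w ∈ Cs u)
    (hw : (G.degree w : ℝ) ≤ (3 + η) * φ)
    (t : ℝ) (ht : 0 < t)
    (hint : ((closedNbr G w ∩ closedNbr G v ∩ closedNbr G u).card : ℝ) = φ + t) :
    ((symmDiff (closedNbr G w) (closedNbr G u)).card : ℝ) ≤ 2 * (φ - t) := by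
  have hw_cl : Cs w = Cs u := hCpart w u hwu
  have hnot : ∀ x, x ∈ Cs u → x ∉ Cs v := fun x hxu hxv =>
    huv ((hCpart x u hxu).symm.trans (hCpart x v hxv))
  have hsub : closedNbr G w ∩ closedNbr G v ∩ closedNbr G u ⊆
      symmDiff (closedNbr G v) (Cs v) ∪ (closedNbr G w ∩ closedNbr G u) \ Cs u := by
    intro x
    have := hnot x
    simp only [mem_union, mem_symmDiff, mem_sdiff, mem_inter]
    tauto
  have hcard := (card_le_card hsub).trans (card_union_le _ _)
  have htri := card_symmDiff_add_two_mul_card_inter_sdiff_le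
    (closedNbr G w) (closedNbr G u) (Cs u)
  have hρu := card_symmDiff_closedNbr_le_clObj G Cs u
  have hρv := card_symmDiff_closedNbr_le_clObj G Cs v
  have hρw := card_symmDiff_closedNbr_le_clObj G Cs w
  rw [hw_cl] at hρw
  rify at hcard htri hρu hρv hρw
  linarith
end

section
/- Let φ ≥ 0 and η ∈ [0,1) be real numbers, and let 𝒞* be a clustering with obj(𝒞*) ≤ φ. Let u and v be vertices with deg(u) > (3+η)φ and deg(v) > (3+η)φ lying in different clusters of 𝒞* (𝒞*_u ≠ 𝒞*_v), and let w be a vertex with deg(w) ≤ (3+η)φ. If w ∈ 𝒞*_u and |N[v] ∩ N[u] ∩ N[w]| > φ, then |N[v] Δ N[w]| > (1+η)·2φ. -/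
open Finset

theorem card_add_card_eq_card_symmDiff_add {α : Type*} [DecidableEq α] (S T : Finset α) :
    S.card + T.card = (symmDiff S T).card + 2 * (S ∩ T).card := by
  have h : (symmDiff S T).card = (S \ T).card + (T \ S).card :=
    card_union_of_disjoint disjoint_sdiff_sdiff
  have hS := card_sdiff_add_card_inter S T
  have hT := card_sdiff_add_card_inter T S
  rw [inter_comm] at hT
  omega

theorem card_closedNbr {V : Type*} [Fintype V] [DecidableEq V]
    (G : SimpleGraph V) [DecidableRel G.Adj] (v : V) :
    (closedNbr G v).card = G.degree v + 1 := by
  simp [closedNbr]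

/-- Two sets that are close to disjoint sets `A` and `B` have small intersection. -/
theorem card_inter_le_card_sdiff_add_card_sdiff {α : Type*} [DecidableEq α]
    {S T A B : Finset α} (h : Disjoint A B) :
    (S ∩ T).card ≤ (S \ B).card + (T \ A).card := by
  refine (card_le_card fun x hx => ?_).trans (card_union_le _ _)
  have hx' : x ∈ A → x ∉ B := fun hA => Finset.disjoint_left.mp h hA
  simp only [mem_inter, mem_union, mem_sdiff] at *
  tauto

/-- No stealing, hard case: under the assumption $|N[v] ∩ N[u] ∩ N[w]| > φ$. -/
theorem no_stealing_hard
    {V : Type*} [Fintype V] [DecidableEq V]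
    (G : SimpleGraph V) [DecidableRel G.Adj]
    (φ η : ℝ) (hφ : 0 ≤ φ) (hη0 : 0 ≤ η) (hη1 : η < 1)
    (Cs : V → Finset V)
    (hCmem : ∀ z, z ∈ Cs z)
    (hCpart : ∀ z w, z ∈ Cs w → Cs z = Cs w)
    (hobj : (clObj G Cs : ℝ) ≤ φ)
    (u v w : V)
    (hu : (3 + η) * φ < (G.degree u : ℝ))
    (hv : (3 + η) * φ < (G.degree v : ℝ))
    (huv : Cs u ≠ Cs v)
    (hw : (G.degree w : ℝ) ≤ (3 + η) * φ)
    (hwu : w ∈ Cs u)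
    (hint : φ < ((closedNbr G v ∩ closedNbr G u ∩ closedNbr G w).card : ℝ)) :
    (1 + η) * (2 * φ) < ((symmDiff (closedNbr G v) (closedNbr G w)).card : ℝ) := by
  have hdisj : Disjoint (Cs u) (Cs v) := Finset.disjoint_left.mpr fun x hxu hxv =>
    huv ((hCpart x u hxu).symm.trans (hCpart x v hxv))
  have hou := card_symmDiff_le_clObj G Cs u
  have hov := card_symmDiff_le_clObj G Cs v
  have how := card_symmDiff_le_clObj G Cs w
  rw [hCpart w u hwu] at how
  have hinter := card_inter_le_card_sdiff_add_card_sdiff (S := closedNbr G v)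
    (T := closedNbr G w) hdisj
  have hvB : (closedNbr G v \ Cs v).card ≤ (symmDiff (closedNbr G v) (Cs v)).card :=
    card_le_card subset_union_left
  have hwsplit : (symmDiff (closedNbr G w) (Cs u)).card =
      (closedNbr G w \ Cs u).card + (Cs u \ closedNbr G w).card :=
    card_union_of_disjoint disjoint_sdiff_sdiff
  have hw1 := card_sdiff_add_card_inter (closedNbr G w) (Cs u)
  have hw2 := card_sdiff_add_card_inter (Cs u) (closedNbr G w)
  rw [inter_comm] at hw2
  have huA : (closedNbr G u \ Cs u).card ≤ (symmDiff (closedNbr G u) (Cs u)).card :=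
    card_le_card subset_union_left
  have hu1 := card_sdiff_add_card_inter (closedNbr G u) (Cs u)
  have hu2 : (closedNbr G u ∩ Cs u).card ≤ (Cs u).card := card_le_card inter_subset_right
  have hvw := card_add_card_eq_card_symmDiff_add (closedNbr G v) (closedNbr G w)
  have hcu := card_closedNbr G u
  have hcv := card_closedNbr G v
  have key : G.degree u + G.degree v ≤
      (symmDiff (closedNbr G v) (closedNbr G w)).card + 4 * clObj G Cs := by
    omega
  have keyR : (G.degree u : ℝ) + G.degree v ≤
      (symmDiff (closedNbr G v) (closedNbr G w)).card + 4 * clObj G Cs := by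
    exact_mod_cast key
  linarith
end

section
/- Let V be a finite set partitioned into V_low and V_high = V \ V_low, let u ∈ V, let N ⊆ V be a set containing u, and let φ ≥ 0 be a real number. Suppose A, B ⊆ V satisfy: (i) A ∩ V_high = B ∩ V_high; (ii) B ∩ V_low ⊆ N; (iii) A ∩ N ⊆ B; (iv) u ∈ A; and (v) |N Δ A| ≤ φ. Then |N Δ B| ≤ φ and |A Δ B| ≤ φ. (Here A plays the role of the optimal cluster C*_i, B the algorithm's cluster C_i, and N the closed neighborhood N[u_i] of the pivot.) -/
open Finset

/-- Closeness (abstract form): if `A ∩ V_high = B ∩ V_high`, `B ∩ V_low ⊆ N`,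
`A ∩ N ⊆ B`, `u ∈ A`, `u ∈ N` and `|N Δ A| ≤ φ`, then `|N Δ B| ≤ φ` and `|A Δ B| ≤ φ`. -/
theorem closeness
    {V : Type*} [Fintype V] [DecidableEq V]
    (Vlow : Finset V) (u : V) (N : Finset V) (hu : u ∈ N)
    (φ : ℝ) (hφ : 0 ≤ φ)
    (A B : Finset V)
    (h1 : A ∩ (Finset.univ \ Vlow) = B ∩ (Finset.univ \ Vlow))
    (h2 : B ∩ Vlow ⊆ N)
    (h3 : A ∩ N ⊆ B)
    (h4 : u ∈ A)
    (h5 : ((symmDiff N A).card : ℝ) ≤ φ) :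
    ((symmDiff N B).card : ℝ) ≤ φ ∧ ((symmDiff A B).card : ℝ) ≤ φ := by
  have hiff (x : V) (hx : x ∉ Vlow) : x ∈ A ↔ x ∈ B := by
    simpa [hx] using Finset.ext_iff.mp h1 x
  have hlow (x : V) (hB : x ∈ B) (hx : x ∈ Vlow) : x ∈ N :=
    h2 (mem_inter.mpr ⟨hB, hx⟩)
  have hAN (x : V) (hA : x ∈ A) (hN : x ∈ N) : x ∈ B :=
    h3 (mem_inter.mpr ⟨hA, hN⟩)
  have hNB : symmDiff N B ⊆ symmDiff N A := by
    intro x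
    simp only [mem_symmDiff]
    have := hiff x
    have := hlow x
    have := hAN x
    tauto
  have hAB : symmDiff A B ⊆ symmDiff N A := by
    intro x
    simp only [mem_symmDiff]
    have := hiff x
    have := hlow x
    have := hAN x
    tauto
  exact ⟨le_trans (mod_cast card_le_card hNB) h5, le_trans (mod_cast card_le_card hAB) h5⟩
end

section
/- Let φ ≥ 0 and η ∈ [0,1) be real numbers, and let 𝒞* be a clustering with obj(𝒞*) ≤ φ. Let 𝒞 be a clustering of V such that every cluster C ∈ 𝒞 satisfies at least one of: (a) C = {v} is a singleton with deg(v) ≤ (3+η)φ; or (b) there exist a cluster C* ∈ 𝒞* and a vertex u ∈ C ∩ C* such that |C* Δ C| ≤ φ, |N[u] Δ C| ≤ φ, and every vertex v ∈ C \ C* satisfies |N[v] Δ N[u]| ≤ (2+η)φ. Then obj(𝒞) ≤ (3+η)φ. -/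
open Finset

/-- If every cluster of $\mathcal{C}$ is either a low-degree singleton, or is close to
an optimal cluster with a pivot $u$ as in the algorithm, then
$obj(\mathcal{C}) ≤ (3+η)φ$. -/
theorem approx_guarantee
    {V : Type*} [Fintype V] [DecidableEq V]
    (G : SimpleGraph V) [DecidableRel G.Adj]
    (φ η : ℝ) (hφ : 0 ≤ φ) (hη0 : 0 ≤ η) (hη1 : η < 1)
    (Cs : V → Finset V)
    (hCsmem : ∀ z, z ∈ Cs z)
    (hCspart : ∀ z w, z ∈ Cs w → Cs z = Cs w)
    (hobjs : (clObj G Cs : ℝ) ≤ φ)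
    (C : V → Finset V)
    (hCmem : ∀ z, z ∈ C z)
    (hCpart : ∀ z w, z ∈ C w → C z = C w)
    (hclusters : ∀ x : V,
      (∃ v : V, C x = {v} ∧ (G.degree v : ℝ) ≤ (3 + η) * φ) ∨
      (∃ y u : V, u ∈ C x ∧ u ∈ Cs y ∧
        ((symmDiff (Cs y) (C x)).card : ℝ) ≤ φ ∧
        ((symmDiff (closedNbr G u) (C x)).card : ℝ) ≤ φ ∧
        ∀ v ∈ C x, v ∉ Cs y →
          ((symmDiff (closedNbr G v) (closedNbr G u)).card : ℝ) ≤ (2 + η) * φ)) :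
    (clObj G C : ℝ) ≤ (3 + η) * φ := by
  have triangle (A B D : Finset V) :
      ((symmDiff A D).card : ℝ) ≤ (symmDiff A B).card + (symmDiff B D).card := by
    exact_mod_cast (card_le_card (symmDiff_triangle A B D)).trans (card_union_le _ _)
  have hbound : 0 ≤ (3 + η) * φ := by positivity
  have hηφ : 0 ≤ η * φ := by positivity
  rw [← Nat.le_floor_iff hbound]
  refine Finset.sup_le fun z _ => ?_
  rw [Nat.le_floor_iff hbound]
  rcases hclusters z with ⟨v, hv, hdeg⟩ | ⟨y, u, -, -, hstar, hpivot, hfar⟩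
  · obtain rfl : z = v := by simpa [hv] using hCmem z
    have hsub : symmDiff (closedNbr G z) {z} ⊆ G.neighborFinset z := by
      intro w hw
      simp only [closedNbr, mem_symmDiff, mem_insert, mem_singleton] at hw
      tauto
    rw [hv]
    exact le_trans (mod_cast card_le_card hsub) hdeg
  · by_cases hz : z ∈ Cs y
    · have hopt : ((symmDiff (closedNbr G z) (Cs y)).card : ℝ) ≤ φ := by
        rw [← hCspart z y hz]
        refine le_trans ?_ hobjs
        exact_mod_cast Finset.le_sup (f := fun v => (symmDiff (closedNbr G v) (Cs v)).card)
          (mem_univ z)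
      linarith [triangle (closedNbr G z) (Cs y) (C z)]
    · linarith [triangle (closedNbr G z) (closedNbr G u) (C z), hfar z (hCmem z) hz]
end

section
/- Let 𝒞* be a clustering of V, let u and w be vertices with w ∈ 𝒞*_u, and let S be any subset of N[u] ∩ N[w]. Then ρ_{𝒞*}(u) + ρ_{𝒞*}(w) ≥ 2·|S \ 𝒞*_u| + |N[w] Δ N[u]|. -/
open Finset

/-- The triangle inequality for symmetric differences, strengthened by the part of `A ∩ B`
lying outside the intermediate set `C`. -/
theorem two_mul_card_sdiff_add_card_symmDiff_le {α : Type*} [DecidableEq α]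
    {A B C S : Finset α} (hS : S ⊆ A ∩ B) :
    2 * (S \ C).card + (symmDiff B A).card ≤ (symmDiff A C).card + (symmDiff B C).card := by
  have hinter : (S \ C).card ≤ (symmDiff A C ∩ symmDiff B C).card := by
    refine card_le_card fun x hx => ?_
    have := @hS x
    simp only [mem_sdiff, mem_inter, mem_symmDiff] at *
    tauto
  have hdisj : Disjoint (S \ C) (symmDiff B A) := by
    refine disjoint_left.2 fun x hx => ?_
    have := @hS x
    simp only [mem_sdiff, mem_inter, mem_symmDiff] at *
    tauto
  have hunion : (S \ C ∪ symmDiff B A).card ≤ (symmDiff A C ∪ symmDiff B C).card := by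
    refine card_le_card fun x hx => ?_
    have := @hS x
    simp only [mem_sdiff, mem_inter, mem_union, mem_symmDiff] at *
    tauto
  rw [card_union_of_disjoint hdisj] at hunion
  have := card_union_add_card_inter (symmDiff A C) (symmDiff B C)
  omega

/-- If $w ∈ C^*_u$ and $S ⊆ N[u] ∩ N[w]$, then
$ρ(u) + ρ(w) ≥ 2|S \ C^*_u| + |N[w] Δ N[u]|$. -/
theorem disagreement_lower_bound
    {V : Type*} [Fintype V] [DecidableEq V]
    (G : SimpleGraph V) [DecidableRel G.Adj]
    (Cs : V → Finset V)
    (hCmem : ∀ z, z ∈ Cs z)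
    (hCpart : ∀ z w, z ∈ Cs w → Cs z = Cs w)
    (u w : V) (hwu : w ∈ Cs u)
    (S : Finset V) (hS : S ⊆ closedNbr G u ∩ closedNbr G w) :
    2 * (S \ Cs u).card + (symmDiff (closedNbr G w) (closedNbr G u)).card ≤
      (symmDiff (closedNbr G u) (Cs u)).card + (symmDiff (closedNbr G w) (Cs w)).card := by
  rw [hCpart w u hwu]
  exact two_mul_card_sdiff_add_card_symmDiff_le hS
end

section
/- Let φ ≥ 0 and η ∈ [0,1) be real numbers. Let u, v, w be vertices with deg(u) > (3+η)φ and deg(v) > (3+η)φ, and suppose |N[v] ∩ N[u] ∩ N[w]| ≤ φ. Then |N[v] Δ N[w]| + |N[u] Δ N[w]| > (4+2η)φ. -/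
open Finset

theorem card_le_card_sdiff_add_card_inter_add_card_sdiff {α : Type*} [DecidableEq α]
    (s t r : Finset α) :
    s.card ≤ (s \ r).card + (s ∩ t ∩ r).card + (r \ t).card := by
  have hsub : s ⊆ (s \ r) ∪ (s ∩ t ∩ r) ∪ (r \ t) := by
    intro x hx
    simp only [mem_union, mem_sdiff, mem_inter]
    tauto
  exact (card_le_card hsub).trans
    ((card_union_le _ _).trans (Nat.add_le_add_right (card_union_le _ _) _))

theorem card_add_card_le_card_symmDiff_add_card_symmDiff {α : Type*} [DecidableEq α]
    (s t r : Finset α) :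
    s.card + t.card ≤
      (symmDiff s r).card + (symmDiff t r).card + 2 * (s ∩ t ∩ r).card := by
  have hs := card_le_card_sdiff_add_card_inter_add_card_sdiff s t r
  have ht := card_le_card_sdiff_add_card_inter_add_card_sdiff t s r
  rw [inter_comm t s] at ht
  rw [card_symmDiff_eq_add, card_symmDiff_eq_add]
  omega

/-- If $deg(u), deg(v) > (3+η)φ$ and $|N[v] ∩ N[u] ∩ N[w]| ≤ φ$, then
$|N[v] Δ N[w]| + |N[u] Δ N[w]| > (4+2η)φ$. -/
theorem symmDiff_sum_lower_bound
    {V : Type*} [Fintype V] [DecidableEq V]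
    (G : SimpleGraph V) [DecidableRel G.Adj]
    (φ η : ℝ) (hφ : 0 ≤ φ) (hη0 : 0 ≤ η) (hη1 : η < 1)
    (u v w : V)
    (hu : (3 + η) * φ < (G.degree u : ℝ))
    (hv : (3 + η) * φ < (G.degree v : ℝ))
    (hint : ((closedNbr G v ∩ closedNbr G u ∩ closedNbr G w).card : ℝ) ≤ φ) :
    (4 + 2 * η) * φ <
      ((symmDiff (closedNbr G v) (closedNbr G w)).card : ℝ) +
        ((symmDiff (closedNbr G u) (closedNbr G w)).card : ℝ) := by
  have hsum : (G.degree v : ℝ) + G.degree u ≤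
      (symmDiff (closedNbr G v) (closedNbr G w)).card +
        (symmDiff (closedNbr G u) (closedNbr G w)).card +
          2 * (closedNbr G v ∩ closedNbr G u ∩ closedNbr G w).card := by
    exact_mod_cast (Nat.add_le_add (degree_le_card_closedNbr G v)
      (degree_le_card_closedNbr G u)).trans
        (card_add_card_le_card_symmDiff_add_card_symmDiff _ _ _)
  linarith
end
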